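/- arXiv:2511.19999 — 3 statements merged into one kernel-verified Lean document; each statement's English description precedes it below -/
import Mathlib

section
/- Suppose Y ≠ 0 (so σ₁ > 0) and r ≠ 0. Then the top right singular vector q₁ can be chosen entrywise nonnegative, and for this choice, if moreover σ₁² ≥ vol(I) − r_max, then cos(r, q₁) := ⟨r, q₁⟩ / ‖r‖ satisfies cos(r, q₁) ≥ (σ₁² / √(vol₂(I))) · √(1 − (vol(I) − r_max)/σ₁²). -/
open Matrix Finset

/-- A symmetric matrix diagonalised by an orthonormal basis with nonnegative eigenvalues is positive
semidefinite. -/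
theorem posSemidef_of_orthonormal_eigenbasis {m : ℕ} (M : Matrix (Fin m) (Fin m) ℝ)
    (q : Fin m → Fin m → ℝ) (μ : Fin m → ℝ) (hμ : ∀ i, 0 ≤ μ i)
    (horth : ∀ i j, q i ⬝ᵥ q j = if i = j then (1 : ℝ) else 0)
    (heig : ∀ i, M *ᵥ q i = μ i • q i) : M.PosSemidef := by
  set Q : Matrix (Fin m) (Fin m) ℝ := Matrix.of q with hQ
  have h1 : Q * Qᵀ = 1 := by
    ext i j
    rw [Matrix.one_apply, ← horth i j]
    rfl
  have h2 : Qᵀ * Q = 1 := mul_eq_one_comm.mp h1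
  have h3 : M * Qᵀ = Qᵀ * Matrix.diagonal μ := by
    ext i j
    rw [Matrix.mul_diagonal]
    have := congrFun (heig j) i
    rw [Pi.smul_apply, smul_eq_mul, mul_comm] at this
    exact this
  have h4 : M = Qᵀ * Matrix.diagonal μ * Q := by
    rw [← h3, Matrix.mul_assoc, h2, Matrix.mul_one]
  have h5 : (Matrix.diagonal μ).PosSemidef := Matrix.PosSemidef.diagonal hμ
  rw [h4]
  simpa using h5.conjTranspose_mul_mul_same Q

/-- For an entrywise nonnegative matrix with top eigenvalue `l`, the absolute value of a top
eigenvector is again a top eigenvector. -/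
theorem mulVec_abs_eq_smul {m : ℕ} (A : Matrix (Fin m) (Fin m) ℝ) (hA : ∀ i j, 0 ≤ A i j) (l : ℝ)
    (hM : (l • (1 : Matrix (Fin m) (Fin m) ℝ) - A).PosSemidef) (x : Fin m → ℝ)
    (hx : A *ᵥ x = l • x) : A *ᵥ (fun i => |x i|) = l • (fun i => |x i|) := by
  set z : Fin m → ℝ := fun i => |x i| with hz
  have hexp : ∀ v : Fin m → ℝ,
      (l • (1 : Matrix (Fin m) (Fin m) ℝ) - A) *ᵥ v = l • v - A *ᵥ v := fun v => by
    rw [Matrix.sub_mulVec, Matrix.smul_mulVec, Matrix.one_mulVec]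
  have hzz : z ⬝ᵥ z = x ⬝ᵥ x := by simp [dotProduct, hz]
  have hle : x ⬝ᵥ (A *ᵥ x) ≤ z ⬝ᵥ (A *ᵥ z) := by
    simp only [dotProduct, mulVec, Finset.mul_sum]
    refine Finset.sum_le_sum fun i _ => Finset.sum_le_sum fun j _ => ?_
    refine (le_abs_self _).trans (le_of_eq ?_)
    rw [abs_mul, abs_mul, abs_of_nonneg (hA i j)]
  rw [hx, dotProduct_smul] at hle
  have h0 : star z ⬝ᵥ ((l • (1 : Matrix (Fin m) (Fin m) ℝ) - A) *ᵥ z) = 0 := by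
    refine le_antisymm ?_ (hM.dotProduct_mulVec_nonneg z)
    rw [star_trivial, hexp, dotProduct_sub, dotProduct_smul, hzz]
    linarith
  have h1 := (hM.dotProduct_mulVec_zero_iff z).mp h0
  rw [hexp] at h1
  exact (sub_eq_zero.mp h1).symm

/-- Lower bound on the correlation of the column sums of a 0/1 matrix with a nonnegative right
singular vector. -/
theorem sq_dotProduct_colSum_ge {n m : ℕ} (Y : Matrix (Fin n) (Fin m) ℝ)
    (hY : ∀ u i, Y u i = 0 ∨ Y u i = 1) (x : Fin m → ℝ) (hx0 : ∀ i, 0 ≤ x i)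
    (hx1 : x ⬝ᵥ x = 1) (l : ℝ) (hx : (Yᵀ * Y) *ᵥ x = l • x) (k : Fin m) :
    l * (l - (∑ i, (Yᵀ *ᵥ fun _ => (1 : ℝ)) i - (Yᵀ *ᵥ fun _ => (1 : ℝ)) k)) ≤
      ((Yᵀ *ᵥ fun _ => (1 : ℝ)) ⬝ᵥ x) ^ 2 := by
  set r := Yᵀ *ᵥ fun _ => (1 : ℝ) with hr
  set y := Y *ᵥ x with hy
  have hY0 : ∀ u i, 0 ≤ Y u i := fun u i => by rcases hY u i with h | h <;> simp [h]
  have hY1 : ∀ u i, Y u i ≤ 1 := fun u i => by rcases hY u i with h | h <;> simp [h]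
  have hy0 : ∀ u, 0 ≤ y u := fun u => dotProduct_nonneg_of_nonneg (hY0 u) hx0
  have hYy : ∀ i, ∑ u, Y u i * y u = l * x i := fun i => by
    have := congrFun hx i
    rwa [← Matrix.mulVec_mulVec] at this
  have hS : r ⬝ᵥ x = ∑ u, y u := by
    rw [hr, Matrix.mulVec_transpose, ← Matrix.dotProduct_mulVec]
    simp [dotProduct, hy]
  have hyy : ∑ u, y u ^ 2 = l := by
    have h : x ⬝ᵥ ((Yᵀ * Y) *ᵥ x) = y ⬝ᵥ y := by
      rw [← Matrix.mulVec_mulVec, Matrix.dotProduct_mulVec, Matrix.vecMul_transpose]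
    rw [hx, dotProduct_smul, hx1] at h
    simpa [dotProduct, sq] using h.symm
  have hrsum : ∀ i, ∑ u, Y u i ^ 2 = r i := fun i => by
    simp only [hr, mulVec, dotProduct, mul_one, transpose_apply]
    refine Finset.sum_congr rfl fun u _ => ?_
    rcases hY u i with h | h <;> simp [h]
  have hCS : ∀ i, (l * x i) ^ 2 ≤ r i * l := fun i => by
    rw [← hYy, ← hrsum, ← hyy]
    exact Finset.sum_mul_sq_le_sq_mul_sq _ _ _
  have hl1 : (l * x k) ^ 2 ≤ (r ⬝ᵥ x) ^ 2 := by
    rw [← hYy, hS]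
    refine pow_le_pow_left₀ (Finset.sum_nonneg fun u _ => mul_nonneg (hY0 u k) (hy0 u)) ?_ 2
    exact Finset.sum_le_sum fun u _ => mul_le_of_le_one_left (hy0 u) (hY1 u k)
  have hl2 : l ^ 2 = ∑ i, (l * x i) ^ 2 := by
    simp only [mul_pow, ← Finset.mul_sum]
    have : ∑ i, x i ^ 2 = 1 := by simpa [dotProduct, sq] using hx1
    rw [this, mul_one]
  have hrest : ∑ i ∈ Finset.univ.erase k, (l * x i) ^ 2 ≤
      (∑ i ∈ Finset.univ.erase k, r i) * l := by
    rw [Finset.sum_mul]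
    exact Finset.sum_le_sum fun i _ => hCS i
  rw [← Finset.add_sum_erase _ _ (Finset.mem_univ k)] at hl2 ⊢
  nlinarith

/-- Popularity Bias Memorization, Theorem 1A, part A.
`Y` is an `n × m` 0/1 interaction matrix, `r = Yᵀ e` the popularity vector,
`σ` the decreasingly ordered singular values of `Y` (so `σ i ^ 2` are the
eigenvalues of `YᵀY`, realized by the orthonormal eigenbasis `q`).
If `Y ≠ 0` and `r ≠ 0`, then the top right singular vector can be chosen
entrywise nonnegative, and for this choice, if `σ₁² ≥ vol(I) - r_max`, then
`cos(r, q₁) = ⟨r, q₁⟩ / ‖r‖ ≥ (σ₁² / √vol₂(I)) · √(1 - (vol(I) - r_max)/σ₁²)`. -/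
theorem popularity_bias_memorization_A
    (n m : ℕ) (hn : 0 < n) (hm : 0 < m)
    (Y : Matrix (Fin n) (Fin m) ℝ)
    (hY01 : ∀ u i, Y u i = 0 ∨ Y u i = 1)
    (hYne : Y ≠ 0)
    (r : Fin m → ℝ) (hr : r = Yᵀ *ᵥ (fun _ => 1))
    (hrne : r ≠ 0)
    (volI vol2 rmax : ℝ)
    (hvolI : volI = ∑ i, r i)
    (hvol2 : vol2 = ∑ i, (r i) ^ 2)
    (hrmax : IsGreatest (Set.range r) rmax)
    (σ : Fin m → ℝ) (q : Fin m → Fin m → ℝ)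
    (hσnonneg : ∀ i, 0 ≤ σ i)
    (hσmono : ∀ i j : Fin m, i ≤ j → σ j ≤ σ i)
    (horth : ∀ i j, q i ⬝ᵥ q j = if i = j then (1 : ℝ) else 0)
    (heig : ∀ i, (Yᵀ * Y) *ᵥ q i = (σ i ^ 2) • q i) :
    ∃ q1 : Fin m → ℝ,
      (∀ i, 0 ≤ q1 i) ∧
      q1 ⬝ᵥ q1 = 1 ∧
      (Yᵀ * Y) *ᵥ q1 = (σ ⟨0, hm⟩ ^ 2) • q1 ∧
      (σ ⟨0, hm⟩ ^ 2 ≥ volI - rmax →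
        r ⬝ᵥ q1 / Real.sqrt vol2 ≥
          σ ⟨0, hm⟩ ^ 2 / Real.sqrt vol2 *
            Real.sqrt (1 - (volI - rmax) / σ ⟨0, hm⟩ ^ 2)) := by
  have hApos : ∀ i j, 0 ≤ (Yᵀ * Y) i j := fun i j => by
    rw [Matrix.mul_apply]
    refine Finset.sum_nonneg fun u _ => ?_
    rcases hY01 u i with h | h <;> rcases hY01 u j with h' | h' <;> simp [h, h']
  have hM : ((σ ⟨0, hm⟩ ^ 2) • (1 : Matrix (Fin m) (Fin m) ℝ) - Yᵀ * Y).PosSemidef := by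
    refine posSemidef_of_orthonormal_eigenbasis _ q (fun i => σ ⟨0, hm⟩ ^ 2 - σ i ^ 2)
      (fun i => sub_nonneg.mpr ?_) horth fun i => ?_
    · exact pow_le_pow_left₀ (hσnonneg i) (hσmono _ _ (Nat.zero_le _)) 2
    · rw [Matrix.sub_mulVec, Matrix.smul_mulVec, Matrix.one_mulVec, heig, sub_smul]
  have hunit : (fun i => |q ⟨0, hm⟩ i|) ⬝ᵥ (fun i => |q ⟨0, hm⟩ i|) = (1 : ℝ) := by
    have := horth ⟨0, hm⟩ ⟨0, hm⟩
    simpa [dotProduct] using this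
  have hAx := mulVec_abs_eq_smul _ hApos _ hM _ (heig ⟨0, hm⟩)
  refine ⟨fun i => |q ⟨0, hm⟩ i|, fun i => abs_nonneg _, hunit, hAx, fun hge => ?_⟩
  obtain ⟨⟨k, hk⟩, -⟩ := hrmax
  have key := sq_dotProduct_colSum_ge Y hY01 _ (fun i => abs_nonneg _) hunit _ hAx k
  rw [← hr, ← hvolI, hk] at key
  have hr0 : ∀ i, 0 ≤ r i := fun i => by
    rw [hr]
    refine dotProduct_nonneg_of_nonneg (fun u => ?_) fun _ => zero_le_one
    rcases hY01 u i with h | h <;> simp [h]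
  have hS0 : 0 ≤ r ⬝ᵥ (fun i => |q ⟨0, hm⟩ i|) :=
    Finset.sum_nonneg fun i _ => mul_nonneg (hr0 i) (abs_nonneg _)
  rw [ge_iff_le, div_mul_eq_mul_div]
  refine div_le_div_of_nonneg_right ?_ (Real.sqrt_nonneg _)
  generalize σ ⟨0, hm⟩ ^ 2 = l at *
  rcases le_or_gt l 0 with hl | hl
  · exact (mul_nonpos_of_nonpos_of_nonneg hl (Real.sqrt_nonneg _)).trans hS0
  · refine abs_le_of_sq_le_sq' ?_ hS0 |>.2
    have hfrac : 0 ≤ 1 - (volI - rmax) / l := by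
      rw [sub_nonneg, div_le_one hl]
      exact hge
    rw [mul_pow, Real.sq_sqrt hfrac]
    refine le_trans (le_of_eq ?_) key
    field_simp
end

section
/- Suppose Y ≠ 0 (so σ₁ > 0), r ≠ 0, and q₁ is chosen entrywise nonnegative (so that p₁ = (1/σ₁) Y q₁ is also entrywise nonnegative). Then for every item index s, cos(r, q₁) := ⟨r, q₁⟩ / ‖r‖ ≥ σ₁² · q₁(s) / √(vol₂(I)), where q₁(s) is the s-th coordinate of q₁. -/
open Matrix Finset

/-- For an entrywise nonnegative matrix `Y` with entries at most one and a nonnegative vector `v`,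
every coordinate of `YᵀY v` is at most `⟨Yᵀ 1, v⟩`. -/
theorem transpose_mul_self_mulVec_apply_le {ι κ : Type*} [Fintype ι] [Fintype κ]
    (Y : Matrix ι κ ℝ) (hY0 : ∀ u i, 0 ≤ Y u i) (hY1 : ∀ u i, Y u i ≤ 1)
    (v : κ → ℝ) (hv : ∀ i, 0 ≤ v i) (s : κ) :
    ((Yᵀ * Y) *ᵥ v) s ≤ (Yᵀ *ᵥ (fun _ => 1)) ⬝ᵥ v := by
  have hsum : (Yᵀ *ᵥ (fun _ => 1)) ⬝ᵥ v = ∑ u, (Y *ᵥ v) u := by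
    rw [Matrix.mulVec_transpose, ← Matrix.dotProduct_mulVec]
    simp [dotProduct]
  rw [hsum, ← Matrix.mulVec_mulVec]
  refine Finset.sum_le_sum fun u _ => ?_
  exact mul_le_of_le_one_left (Finset.sum_nonneg fun i _ => mul_nonneg (hY0 u i) (hv i)) (hY1 u s)

/-- If `Y ≠ 0`, `r ≠ 0` and the top right singular vector
`q₁` is chosen entrywise nonnegative, then for every item index `s`,
`cos(r, q₁) = ⟨r, q₁⟩ / ‖r‖ ≥ σ₁² q₁(s) / √vol₂(I)`.
Here `σ` lists the singular values of `Y` in decreasing order, realized by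
an orthonormal eigenbasis `q` of `YᵀY`, and `q₁ = q 0`. -/
theorem initial_lower_bound
    (n m : ℕ) (hn : 0 < n) (hm : 0 < m)
    (Y : Matrix (Fin n) (Fin m) ℝ)
    (hY01 : ∀ u i, Y u i = 0 ∨ Y u i = 1)
    (hYne : Y ≠ 0)
    (r : Fin m → ℝ) (hr : r = Yᵀ *ᵥ (fun _ => 1))
    (hrne : r ≠ 0)
    (vol2 : ℝ) (hvol2 : vol2 = ∑ i, (r i) ^ 2)
    (σ : Fin m → ℝ) (q : Fin m → Fin m → ℝ)
    (hσnonneg : ∀ i, 0 ≤ σ i)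
    (hσmono : ∀ i j : Fin m, i ≤ j → σ j ≤ σ i)
    (horth : ∀ i j, q i ⬝ᵥ q j = if i = j then (1 : ℝ) else 0)
    (heig : ∀ i, (Yᵀ * Y) *ᵥ q i = (σ i ^ 2) • q i)
    (hq1nonneg : ∀ i, 0 ≤ q ⟨0, hm⟩ i) :
    ∀ s : Fin m,
      r ⬝ᵥ q ⟨0, hm⟩ / Real.sqrt vol2 ≥
        σ ⟨0, hm⟩ ^ 2 * q ⟨0, hm⟩ s / Real.sqrt vol2 := by
  intro s
  have h := transpose_mul_self_mulVec_apply_le Y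
    (fun u i => by rcases hY01 u i with h | h <;> simp [h])
    (fun u i => by rcases hY01 u i with h | h <;> simp [h])
    (q ⟨0, hm⟩) hq1nonneg s
  rw [heig, ← hr] at h
  exact div_le_div_of_nonneg_right h (Real.sqrt_nonneg _)
end

section
/- Suppose Y ≠ 0 (so σ₁ > 0) and q₁ is a unit right singular vector for σ₁. Then for every item index s, the s-th coordinate q₁(s) of q₁ satisfies q₁(s)² ≥ 1 − (vol(I) − r_s)/σ₁². -/
open Matrix Finset

/-- A matrix with real entries that maps an orthonormal basis to zero under its Gram matrix is
itself zero. -/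
theorem eq_zero_of_gram_mulVec_eq_zero {ι κ : Type*} [Fintype ι] [Fintype κ] [DecidableEq κ]
    (Y : Matrix ι κ ℝ) (q : κ → κ → ℝ)
    (horth : ∀ i j, q i ⬝ᵥ q j = if i = j then (1 : ℝ) else 0)
    (hker : ∀ i, (Yᵀ * Y) *ᵥ q i = 0) : Y = 0 := by
  have hQ : Matrix.of q * (Matrix.of q)ᵀ = 1 := by
    ext i j
    simpa [Matrix.mul_apply, Matrix.one_apply, dotProduct] using horth i j
  have hQ' : (Matrix.of q)ᵀ * Matrix.of q = 1 := mul_eq_one_comm.mp hQ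
  have hAQ : (Yᵀ * Y) * (Matrix.of q)ᵀ = 0 := by
    ext i j
    have h := congrFun (hker j) i
    rw [Matrix.mul_apply, Matrix.zero_apply]
    simpa only [Matrix.mulVec, dotProduct, Matrix.transpose_apply, Matrix.of_apply,
      Pi.zero_apply] using h
  have hA : Yᵀ * Y = 0 := by
    rw [← Matrix.mul_one (Yᵀ * Y), ← hQ', ← Matrix.mul_assoc, hAQ, Matrix.zero_mul]
  exact Matrix.conjTranspose_mul_self_eq_zero.mp (by simpa using hA)

/-- Each coordinate of a unit eigenvector of `Yᵀ * Y` is bounded by the squared norm of the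
corresponding column of `Y`. -/
theorem eigenvalue_mul_sq_le_sum_sq {ι κ : Type*} [Fintype ι] [Fintype κ]
    (Y : Matrix ι κ ℝ) (v : κ → ℝ) (c : ℝ) (hc : 0 < c) (hv : v ⬝ᵥ v = 1)
    (heig : (Yᵀ * Y) *ᵥ v = c • v) (i : κ) : c * v i ^ 2 ≤ ∑ u, Y u i ^ 2 := by
  rw [← Matrix.mulVec_mulVec] at heig
  have hnorm : ∑ u, (Y *ᵥ v) u ^ 2 = c := by
    have h : v ⬝ᵥ (Yᵀ *ᵥ (Y *ᵥ v)) = c := by rw [heig, dotProduct_smul, hv]; simp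
    rw [Matrix.dotProduct_mulVec, Matrix.vecMul_transpose] at h
    simpa [dotProduct, sq] using h
  have hcoord : ∑ u, Y u i * (Y *ᵥ v) u = c * v i := congrFun heig i
  have hcs := Finset.sum_mul_sq_le_sq_mul_sq Finset.univ (fun u => Y u i) (Y *ᵥ v)
  rw [hcoord, hnorm] at hcs
  refine le_of_mul_le_mul_right ?_ hc
  linarith [hcs, mul_pow c (v i) 2]

/-- If `Y ≠ 0` (so `σ₁ > 0`) and `q₁` is a unit right
singular vector for `σ₁`, then for every item index `s`,
`q₁(s)² ≥ 1 - (vol(I) - r_s)/σ₁²`.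
Here `σ` lists the singular values of `Y` in decreasing order, realized by
an orthonormal eigenbasis `q` of `YᵀY`, and `q₁ = q 0`. -/
theorem principal_coordinate_lower_bound
    (n m : ℕ) (hn : 0 < n) (hm : 0 < m)
    (Y : Matrix (Fin n) (Fin m) ℝ)
    (hY01 : ∀ u i, Y u i = 0 ∨ Y u i = 1)
    (hYne : Y ≠ 0)
    (r : Fin m → ℝ) (hr : r = Yᵀ *ᵥ (fun _ => 1))
    (volI : ℝ) (hvolI : volI = ∑ i, r i)
    (σ : Fin m → ℝ) (q : Fin m → Fin m → ℝ)
    (hσnonneg : ∀ i, 0 ≤ σ i)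
    (hσmono : ∀ i j : Fin m, i ≤ j → σ j ≤ σ i)
    (horth : ∀ i j, q i ⬝ᵥ q j = if i = j then (1 : ℝ) else 0)
    (heig : ∀ i, (Yᵀ * Y) *ᵥ q i = (σ i ^ 2) • q i) :
    ∀ s : Fin m,
      q ⟨0, hm⟩ s ^ 2 ≥ 1 - (volI - r s) / σ ⟨0, hm⟩ ^ 2 := by
  intro s
  have hσ : 0 < σ ⟨0, hm⟩ := by
    refine (hσnonneg _).lt_of_ne fun h0 => hYne ?_
    refine eq_zero_of_gram_mulVec_eq_zero Y q horth fun i => ?_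
    have hi : σ i = 0 :=
      le_antisymm (h0 ▸ hσmono ⟨0, hm⟩ i (Fin.mk_le_mk.mpr (Nat.zero_le _))) (hσnonneg i)
    rw [heig, hi]
    simp
  have hσ2 : 0 < σ ⟨0, hm⟩ ^ 2 := by positivity
  have hunit : q ⟨0, hm⟩ ⬝ᵥ q ⟨0, hm⟩ = 1 := by simp [horth]
  have hcol : ∀ i, ∑ u, Y u i ^ 2 = r i := by
    intro i
    simp only [hr, Matrix.mulVec, dotProduct, Matrix.transpose_apply, mul_one]
    refine Finset.sum_congr rfl fun u _ => ?_
    rcases hY01 u i with h | h <;> simp [h]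
  have hle : ∑ i ∈ univ.erase s, σ ⟨0, hm⟩ ^ 2 * q ⟨0, hm⟩ i ^ 2 ≤ ∑ i ∈ univ.erase s, r i :=
    Finset.sum_le_sum fun i _ =>
      (eigenvalue_mul_sq_le_sum_sq Y _ _ hσ2 hunit (heig _) i).trans_eq (hcol i)
  have hsq : ∑ i, q ⟨0, hm⟩ i ^ 2 = 1 := by simpa [dotProduct, sq] using hunit
  rw [← Finset.mul_sum] at hle
  have hq := Finset.sum_erase_add univ (fun i => q ⟨0, hm⟩ i ^ 2) (Finset.mem_univ s)
  have hrs := Finset.sum_erase_add univ r (Finset.mem_univ s)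
  rw [ge_iff_le, sub_le_comm, le_div_iff₀ hσ2, hvolI]
  rw [hsq] at hq
  rw [← hrs, ← hq]
  linarith
end
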